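/- Deterministic core of the descent lemma (generally convex case). Let each fᵢ: ℝ^d → ℝ (i = 1,…,n) be convex and L-smooth, let f := (1/n)∑ᵢ fᵢ, let x* be a global minimizer of f, and let 0 < γ ≤ 1/(4L). Then for any points x₁,…,xₙ ∈ ℝ^d with x̄ := (1/n)∑ᵢ xᵢ, ‖ x̄ − x* − (γ/n) ∑_{i=1}^n ∇fᵢ(xᵢ) ‖² ≤ ‖ x̄ − x* ‖² − γ ( f(x̄) − f(x*) ) + (3γL/(2n)) ∑_{i=1}^n ‖ x̄ − xᵢ ‖². -/

import Mathlib

/-- A differentiable function on a real Hilbert space, restricted to a line. -/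
theorem hasDerivAt_comp_line {E : Type*} [NormedAddCommGroup E] [InnerProductSpace ℝ E]
    [CompleteSpace E] {f : E → ℝ} (hf : Differentiable ℝ f) (x v : E) (t : ℝ) :
    HasDerivAt (fun s : ℝ => f (x + s • v)) (inner ℝ (gradient f (x + t • v)) v) t := by
  have hline : HasDerivAt (fun s : ℝ => x + s • v) v t := by
    simpa using ((hasDerivAt_id t).smul_const v).const_add x
  have h := (hf (x + t • v)).hasFDerivAt.comp_hasDerivAt t hline
  rw [inner_gradient_left]
  exact h

/-- First-order characterization of convexity: the tangent plane lies below the graph. -/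
theorem ConvexOn.add_inner_gradient_le {E : Type*} [NormedAddCommGroup E]
    [InnerProductSpace ℝ E] [CompleteSpace E] {f : E → ℝ} (hc : ConvexOn ℝ Set.univ f)
    (hf : Differentiable ℝ f) (x y : E) :
    f x + inner ℝ (gradient f x) (y - x) ≤ f y := by
  have hline : ConvexOn ℝ Set.univ (fun s : ℝ => f (x + s • (y - x))) := by
    have h := hc.comp_affineMap (AffineMap.lineMap x y : ℝ →ᵃ[ℝ] E)
    simpa [Function.comp_def, AffineMap.lineMap_apply, add_comm] using h
  have hd := hasDerivAt_comp_line hf x (y - x) 0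
  have h := hline.le_slope_of_hasDerivAt (Set.mem_univ 0) (Set.mem_univ 1) one_pos hd
  simp only [slope_def_field, zero_smul, one_smul, add_zero, add_sub_cancel, sub_zero,
    div_one] at h
  linarith

/-- The quadratic upper bound for a function with `L`-Lipschitz gradient. -/
theorem le_add_inner_gradient_add_sq {E : Type*} [NormedAddCommGroup E]
    [InnerProductSpace ℝ E] [CompleteSpace E] {f : E → ℝ} {L : ℝ} (hf : Differentiable ℝ f)
    (hlip : ∀ x y, ‖gradient f x - gradient f y‖ ≤ L * ‖x - y‖) (x y : E) :
    f y ≤ f x + inner ℝ (gradient f x) (y - x) + L / 2 * ‖y - x‖ ^ 2 := by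
  set v := y - x with hv
  have hd : ∀ t : ℝ, HasDerivAt
      (fun s : ℝ => f (x + s • v) - (s * inner ℝ (gradient f x) v + s ^ 2 * (L / 2 * ‖v‖ ^ 2)))
      (inner ℝ (gradient f (x + t • v)) v -
        (inner ℝ (gradient f x) v + 2 * t * (L / 2 * ‖v‖ ^ 2))) t := fun t => by
    have h1 := (hasDerivAt_id t).mul_const (inner ℝ (gradient f x) v)
    have h2 := (hasDerivAt_pow 2 t).mul_const (L / 2 * ‖v‖ ^ 2)
    refine ((hasDerivAt_comp_line hf x v t).fun_sub (h1.fun_add h2)).congr_deriv ?_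
    simp
  have hanti := antitoneOn_of_deriv_nonpos (convex_Ici (0 : ℝ))
    (fun t _ => (hd t).continuousAt.continuousWithinAt)
    (fun t _ => (hd t).differentiableAt.differentiableWithinAt) (fun t ht => by
      rw [interior_Ici] at ht
      have ht0 : (0 : ℝ) < t := ht
      rw [(hd t).deriv]
      have h1 : inner ℝ (gradient f (x + t • v) - gradient f x) v ≤ L * t * ‖v‖ ^ 2 := by
        calc _ ≤ ‖gradient f (x + t • v) - gradient f x‖ * ‖v‖ := real_inner_le_norm _ _
          _ ≤ L * ‖x + t • v - x‖ * ‖v‖ := by gcongr; exact hlip _ _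
          _ = L * t * ‖v‖ ^ 2 := by
            rw [add_sub_cancel_left, norm_smul, Real.norm_of_nonneg ht0.le]; ring
      rw [inner_sub_left] at h1
      linarith)
  have h := hanti (Set.mem_Ici.2 le_rfl) (Set.mem_Ici.2 zero_le_one) zero_le_one
  simp only [one_smul, zero_smul, add_zero, hv, add_sub_cancel] at h
  linarith

/-- Jensen's inequality for the squared norm of a finite average. -/
theorem norm_average_sq_le {E ι : Type*} [SeminormedAddCommGroup E] [NormedSpace ℝ E]
    [Fintype ι] [Nonempty ι] (v : ι → E) :
    ‖(Fintype.card ι : ℝ)⁻¹ • ∑ i, v i‖ ^ 2 ≤ (Fintype.card ι : ℝ)⁻¹ * ∑ i, ‖v i‖ ^ 2 := by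
  have hn : (0 : ℝ) < Fintype.card ι := by exact_mod_cast Fintype.card_pos
  have h1 : ‖∑ i, v i‖ ^ 2 ≤ Fintype.card ι * ∑ i, ‖v i‖ ^ 2 :=
    (pow_le_pow_left₀ (norm_nonneg _) (norm_sum_le _ _) 2).trans sq_sum_le_card_mul_sum_sq
  rw [norm_smul, mul_pow, Real.norm_of_nonneg (by positivity)]
  calc _ ≤ (Fintype.card ι : ℝ)⁻¹ ^ 2 * (Fintype.card ι * ∑ i, ‖v i‖ ^ 2) := by gcongr
    _ = _ := by field_simp

/-- If an average of functions with `L`-Lipschitz gradients is minimized at `z`, then the squared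
norm of its gradient is at most `2 * L` times the optimality gap. -/
theorem norm_average_gradient_sq_le {E ι : Type*} [NormedAddCommGroup E]
    [InnerProductSpace ℝ E] [CompleteSpace E] [Fintype ι] [Nonempty ι] {f : ι → E → ℝ} {L : ℝ}
    (hL : 0 < L) (hf : ∀ i, Differentiable ℝ (f i))
    (hlip : ∀ i x y, ‖gradient (f i) x - gradient (f i) y‖ ≤ L * ‖x - y‖) {z : E}
    (hmin : ∀ y, ∑ i, f i z ≤ ∑ i, f i y) (x : E) :
    ‖(Fintype.card ι : ℝ)⁻¹ • ∑ i, gradient (f i) x‖ ^ 2 ≤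
      2 * L * ((Fintype.card ι : ℝ)⁻¹ * (∑ i, f i x - ∑ i, f i z)) := by
  have hn : (0 : ℝ) < Fintype.card ι := by exact_mod_cast Fintype.card_pos
  set g := (Fintype.card ι : ℝ)⁻¹ • ∑ i, gradient (f i) x with hg
  have hsum : ∑ i, gradient (f i) x = (Fintype.card ι : ℝ) • g := by
    rw [hg, smul_inv_smul₀ hn.ne']
  have h := (hmin (x - L⁻¹ • g)).trans (Finset.sum_le_sum fun i _ =>
    le_add_inner_gradient_add_sq (hf i) (hlip i) x (x - L⁻¹ • g))
  have hv : x - L⁻¹ • g - x = -(L⁻¹ • g) := by abel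
  rw [Finset.sum_add_distrib, Finset.sum_add_distrib, ← sum_inner, hsum, hv] at h
  simp only [norm_neg, Finset.sum_const, Finset.card_univ, nsmul_eq_mul, inner_neg_right,
    real_inner_smul_left, real_inner_smul_right, real_inner_self_eq_norm_sq, norm_smul, mul_pow,
    Real.norm_of_nonneg (inv_nonneg.2 hL.le)] at h
  have h2 : (Fintype.card ι : ℝ) * (‖g‖ ^ 2 / (2 * L)) ≤ ∑ i, f i x - ∑ i, f i z := by
    have e : (Fintype.card ι : ℝ) * (‖g‖ ^ 2 / (2 * L)) =
        Fintype.card ι * (L⁻¹ * ‖g‖ ^ 2) -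
          Fintype.card ι * (L / 2 * (L⁻¹ ^ 2 * ‖g‖ ^ 2)) := by field_simp; ring
    have e' : L⁻¹ * (Fintype.card ι * ‖g‖ ^ 2) = Fintype.card ι * (L⁻¹ * ‖g‖ ^ 2) := by ring
    linarith
  calc ‖g‖ ^ 2 = 2 * L * ((Fintype.card ι : ℝ)⁻¹ *
        (Fintype.card ι * (‖g‖ ^ 2 / (2 * L)))) := by field_simp
    _ ≤ _ := by gcongr


/-- Deterministic core of the descent lemma (generally convex case): for convex
`L`-smooth `fᵢ`, global minimizer `x*` of the average `f`, and `0 < γ ≤ 1/(4L)`,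
`‖x̄ − x* − (γ/n)∑ᵢ∇fᵢ(xᵢ)‖² ≤ ‖x̄ − x*‖² − γ(f(x̄) − f(x*)) + (3γL/(2n))∑ᵢ‖x̄ − xᵢ‖²`. -/
theorem descent_core_generally_convex (n d : ℕ) (hn : 0 < n) (L : ℝ) (hL : 0 < L)
    (f : Fin n → EuclideanSpace ℝ (Fin d) → ℝ)
    (hconv : ∀ i, ConvexOn ℝ Set.univ (f i))
    (hdiff : ∀ i, Differentiable ℝ (f i))
    (hlip : ∀ i x y, ‖gradient (f i) x - gradient (f i) y‖ ≤ L * ‖x - y‖)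
    (xstar : EuclideanSpace ℝ (Fin d))
    (hmin : ∀ y, (n : ℝ)⁻¹ * ∑ i, f i xstar ≤ (n : ℝ)⁻¹ * ∑ i, f i y)
    (γ : ℝ) (hγ0 : 0 < γ) (hγ1 : γ ≤ 1 / (4 * L))
    (x : Fin n → EuclideanSpace ℝ (Fin d)) :
    let xb : EuclideanSpace ℝ (Fin d) := (n : ℝ)⁻¹ • ∑ j, x j
    ‖xb - xstar - (γ / (n : ℝ)) • ∑ i, gradient (f i) (x i)‖ ^ 2 ≤
      ‖xb - xstar‖ ^ 2 - γ * ((n : ℝ)⁻¹ * ∑ i, f i xb - (n : ℝ)⁻¹ * ∑ i, f i xstar)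
        + (3 * γ * L / (2 * (n : ℝ))) * ∑ i, ‖xb - x i‖ ^ 2 := by
  intro xb
  have : Nonempty (Fin n) := ⟨⟨0, hn⟩⟩
  have hn' : (0 : ℝ) < n := by exact_mod_cast hn
  have hmin' : ∀ y, ∑ i, f i xstar ≤ ∑ i, f i y := fun y =>
    le_of_mul_le_mul_left (hmin y) (by positivity)
  set G := (n : ℝ)⁻¹ • ∑ i, gradient (f i) (x i) with hG
  set g := (n : ℝ)⁻¹ • ∑ i, gradient (f i) xb with hg
  set V := (n : ℝ)⁻¹ * ∑ i, ‖xb - x i‖ ^ 2 with hV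
  set D := (n : ℝ)⁻¹ * (∑ i, f i xb - ∑ i, f i xstar) with hD
  have hV0 : 0 ≤ V := by positivity
  have hD0 : 0 ≤ D := mul_nonneg (by positivity) (sub_nonneg.2 (hmin' xb))
  have hgrad : ‖g‖ ^ 2 ≤ 2 * L * D := by
    simpa using norm_average_gradient_sq_le hL hdiff hlip hmin' xb
  have hdrift : ‖G - g‖ ^ 2 ≤ L ^ 2 * V := by
    have h := norm_average_sq_le fun i => gradient (f i) (x i) - gradient (f i) xb
    rw [Fintype.card_fin, Finset.sum_sub_distrib, smul_sub] at h
    refine h.trans ?_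
    rw [hV, mul_left_comm, Finset.mul_sum _ _ (L ^ 2)]
    refine mul_le_mul_of_nonneg_left (Finset.sum_le_sum fun i _ => ?_) (inv_nonneg.2 hn'.le)
    rw [← mul_pow, norm_sub_rev xb]
    exact pow_le_pow_left₀ (norm_nonneg _) (hlip i _ _) 2
  have hG2 : ‖G‖ ^ 2 ≤ 2 * (L ^ 2 * V) + 2 * (2 * L * D) := by
    have h : ‖G‖ ≤ ‖G - g‖ + ‖g‖ := by simpa using norm_add_le (G - g) g
    have h' := pow_le_pow_left₀ (norm_nonneg _) h 2
    nlinarith [sq_nonneg (‖G - g‖ - ‖g‖)]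
  have hinner : D - L / 2 * V ≤ inner ℝ (xb - xstar) G := by
    have h : ∀ i, f i xb - f i xstar - L / 2 * ‖xb - x i‖ ^ 2 ≤
        inner ℝ (xb - xstar) (gradient (f i) (x i)) := fun i => by
      have h1 := le_add_inner_gradient_add_sq (hdiff i) (hlip i) (x i) xb
      have h2 := (hconv i).add_inner_gradient_le (hdiff i) (x i) xstar
      rw [real_inner_comm, show xb - xstar = (xb - x i) - (xstar - x i) by abel,
        inner_sub_right]
      linarith
    have hs := mul_le_mul_of_nonneg_left (Finset.sum_le_sum fun i (_ : i ∈ Finset.univ) => h i)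
      (inv_nonneg.2 hn'.le)
    rw [Finset.sum_sub_distrib, Finset.sum_sub_distrib, ← Finset.mul_sum, ← inner_sum,
      ← real_inner_smul_right, mul_sub, mul_left_comm] at hs
    exact hs
  have hγL : γ * L ≤ 1 / 4 := by
    rw [le_div_iff₀ (by positivity)] at hγ1
    linarith
  have hstep : (γ / (n : ℝ)) • ∑ i, gradient (f i) (x i) = γ • G := by
    rw [hG, smul_smul, div_eq_mul_inv]
  have hvar : 3 * γ * L / (2 * (n : ℝ)) * ∑ i, ‖xb - x i‖ ^ 2 = 3 / 2 * (γ * L) * V := by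
    rw [hV]; field_simp
  rw [hstep, hvar, ← mul_sub, ← hD, norm_sub_sq_real, real_inner_smul_right, norm_smul, mul_pow,
    Real.norm_of_nonneg hγ0.le]
  have hquad : γ ^ 2 * ‖G‖ ^ 2 ≤ γ * L * V / 2 + γ * D := by
    have hsq := mul_le_mul_of_nonneg_left hG2 (sq_nonneg γ)
    have hv := mul_le_mul_of_nonneg_right hγL (show 0 ≤ 2 * (γ * L * V) by positivity)
    have hd := mul_le_mul_of_nonneg_right hγL (show 0 ≤ 4 * (γ * D) by positivity)
    nlinarith
  have hlin := mul_le_mul_of_nonneg_left hinner hγ0.le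
  nlinarith
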